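/- arXiv:2402.05800 — 4 statements merged into one kernel-verified Lean document; each statement's English description precedes it below -/
import Mathlib

section
/- Let j ≥ 1 be an integer, let p_1, …, p_j ∈ [0,1] with p_1 + ⋯ + p_j ≤ 1, and let q_1, …, q_j ∈ [0,1]. Let P_Y be the probability measure on {0,1}^j assigning probability p_i to the i-th standard coordinate vector (the vector with a 1 in position i and 0 elsewhere) for each i, probability 1 − Σ_{i=1}^j p_i to the zero vector, and probability 0 to every vector with at least two coordinates equal to 1. Let P_Q be the product measure on {0,1}^j whose i-th marginal is Bernoulli(q_i). Then there exists a probability measure π on {0,1}^j × {0,1}^j with first marginal P_Y and second marginal P_Q such that π({(y,q) : y ≠ q}) ≤ Σ_{i=1}^j |p_i − q_i| + Σ_{i ≠ ℓ} q_i·q_ℓ. -/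
open MeasureTheory Set

/-- Two finite measures of equal mass with a common part `ν` admit a coupling that charges the
off-diagonal by at most the mass of the remaining part. -/
theorem exists_coupling_of_common_part {α : Type*} [Countable α] [MeasurableSpace α]
    [MeasurableSingletonClass α] (ν a b : Measure α) [IsFiniteMeasure a] [IsFiniteMeasure b]
    (hab : a univ = b univ) :
    ∃ π : Measure (α × α), π.map Prod.fst = ν + a ∧ π.map Prod.snd = ν + b ∧
      π {x | x.1 ≠ x.2} ≤ a univ := by
  have hdiag : Measurable fun x : α => (x, x) := by fun_prop
  refine ⟨ν.map (fun x => (x, x)) + (a univ)⁻¹ • a.prod b, ?_, ?_, ?_⟩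
  · rw [Measure.map_add _ _ measurable_fst, Measure.map_map measurable_fst hdiag,
      Measure.map_smul, Measure.map_fst_prod, ← hab]
    congr 1
    · exact Measure.map_id
    · by_cases h : a univ = 0
      · simp [Measure.measure_univ_eq_zero.1 h]
      · rw [smul_smul, ENNReal.inv_mul_cancel h (measure_ne_top _ _), one_smul]
  · rw [Measure.map_add _ _ measurable_snd, Measure.map_map measurable_snd hdiag,
      Measure.map_smul, Measure.map_snd_prod]
    congr 1
    · exact Measure.map_id
    · by_cases h : a univ = 0
      · simp [Measure.measure_univ_eq_zero.1 (hab ▸ h)]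
      · rw [smul_smul, ENNReal.inv_mul_cancel h (measure_ne_top _ _), one_smul]
  · have h0 : ν.map (fun x => (x, x)) {x : α × α | x.1 ≠ x.2} = 0 := by
      rw [Measure.map_apply hdiag (Set.to_countable _).measurableSet]
      simp
    rw [Measure.add_apply, h0, zero_add, Measure.smul_apply, smul_eq_mul]
    calc (a univ)⁻¹ * a.prod b {x | x.1 ≠ x.2}
        ≤ (a univ)⁻¹ * a.prod b univ := by gcongr; exact subset_univ _
      _ = (a univ)⁻¹ * a univ * a univ := by
          rw [← univ_prod_univ, Measure.prod_prod, ← hab, mul_assoc]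
      _ ≤ 1 * a univ := by gcongr; exact ENNReal.inv_mul_le_one _
      _ = a univ := one_mul _

/-- Maximal coupling of two probability measures on a countable space. -/
theorem exists_coupling_measure_ne_le_tsum {α : Type*} [Countable α] [MeasurableSpace α]
    [MeasurableSingletonClass α] (μ ν : Measure α) [IsProbabilityMeasure μ]
    [IsProbabilityMeasure ν] :
    ∃ π : Measure (α × α), IsProbabilityMeasure π ∧ π.map Prod.fst = μ ∧ π.map Prod.snd = ν ∧
      π {x | x.1 ≠ x.2} ≤ ∑' v, (μ {v} - ν {v}) := by
  set c : Measure α := Measure.sum fun v => min (μ {v}) (ν {v}) • Measure.dirac v with hc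
  set a : Measure α := Measure.sum fun v => (μ {v} - ν {v}) • Measure.dirac v with ha
  set b : Measure α := Measure.sum fun v => (ν {v} - μ {v}) • Measure.dirac v with hb
  have hμ : c + a = μ := by
    rw [hc, ha, Measure.sum_add_sum]
    conv_rhs => rw [← Measure.sum_smul_dirac μ]
    congr 1
    funext v
    rw [← add_smul, add_comm, tsub_add_min]
  have hν : c + b = ν := by
    rw [hc, hb, Measure.sum_add_sum]
    conv_rhs => rw [← Measure.sum_smul_dirac ν]
    congr 1
    funext v
    rw [← add_smul, add_comm, min_comm, tsub_add_min]
  have hμu : c univ + a univ = 1 := by rw [← Measure.add_apply, hμ, measure_univ]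
  have hνu : c univ + b univ = 1 := by rw [← Measure.add_apply, hν, measure_univ]
  have hctop : c univ ≠ ⊤ := ne_top_of_le_ne_top ENNReal.one_ne_top (hμu ▸ le_self_add)
  have : IsFiniteMeasure a := ⟨lt_of_le_of_lt (hμu ▸ le_add_self) ENNReal.one_lt_top⟩
  have : IsFiniteMeasure b := ⟨lt_of_le_of_lt (hνu ▸ le_add_self) ENNReal.one_lt_top⟩
  have hab : a univ = b univ := (ENNReal.add_right_inj hctop).1 (hμu.trans hνu.symm)
  obtain ⟨π, h1, h2, h3⟩ := exists_coupling_of_common_part c a b hab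
  rw [hμ] at h1
  rw [hν] at h2
  refine ⟨π, ⟨?_⟩, h1, h2, h3.trans_eq ?_⟩
  · rw [← preimage_univ (f := Prod.fst), ← Measure.map_apply measurable_fst MeasurableSet.univ, h1,
      measure_univ]
  · simp [ha, Measure.sum_apply _ MeasurableSet.univ]

theorem one_sub_sum_le_prod_one_sub {ι : Type*} (s : Finset ι) (q : ι → ℝ)
    (hq : ∀ i, q i ∈ Icc (0 : ℝ) 1) : 1 - ∑ i ∈ s, q i ≤ ∏ i ∈ s, (1 - q i) := by
  classical
  induction s using Finset.induction_on with
  | empty => simp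
  | insert i s hi ih =>
    rw [Finset.sum_insert hi, Finset.prod_insert hi]
    have hs : 0 ≤ ∑ i ∈ s, q i := Finset.sum_nonneg fun i _ => (hq i).1
    nlinarith [mul_le_mul_of_nonneg_left ih (sub_nonneg.2 (hq i).2), mul_nonneg (hq i).1 hs]

open MeasureTheory Set

/-- Coupling lemma (Schweinsberg): a `{0,1}^j`-valued vector `Y` having at most one
coordinate equal to `1` (with `P(Y = e_i) = p_i`) can be coupled with a vector `Q` of
independent Bernoulli(`q_i`) coordinates so that
`P(Y ≠ Q) ≤ Σ_i |p_i − q_i| + Σ_{i ≠ ℓ} q_i·q_ℓ`. -/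
theorem coupling_single_one_with_independent_bernoullis
    (j : ℕ) (hj : 1 ≤ j) (p q : Fin j → ℝ)
    (hp : ∀ i, p i ∈ Set.Icc (0:ℝ) 1) (hpsum : ∑ i, p i ≤ 1)
    (hq : ∀ i, q i ∈ Set.Icc (0:ℝ) 1)
    (PY PQ : Measure (Fin j → Bool))
    (hPYprob : IsProbabilityMeasure PY) (hPQprob : IsProbabilityMeasure PQ)
    (hPYe : ∀ i : Fin j, PY {fun l => decide (l = i)} = ENNReal.ofReal (p i))
    (hPY0 : PY {fun _ => false} = ENNReal.ofReal (1 - ∑ i, p i))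
    (hPY2 : ∀ v : Fin j → Bool,
      (∃ i l : Fin j, i ≠ l ∧ v i = true ∧ v l = true) → PY {v} = 0)
    (hPQ : ∀ v : Fin j → Bool,
      PQ {v} = ∏ i, (if v i then ENNReal.ofReal (q i) else ENNReal.ofReal (1 - q i))) :
    ∃ π : Measure ((Fin j → Bool) × (Fin j → Bool)), IsProbabilityMeasure π ∧
      π.map Prod.fst = PY ∧ π.map Prod.snd = PQ ∧
      π {v | v.1 ≠ v.2}
        ≤ ENNReal.ofReal (∑ i, |p i - q i|
            + ∑ i, ∑ l, if i ≠ l then q i * q l else 0) := by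
  classical
  obtain ⟨π, hπ, h1, h2, h3⟩ := exists_coupling_measure_ne_le_tsum PY PQ
  refine ⟨π, hπ, h1, h2, h3.trans ?_⟩
  rw [tsum_fintype]
  set e : Fin j → Fin j → Bool := fun i l => decide (l = i) with he
  set z : Fin j → Bool := fun _ => false with hz
  have hprod (v : Fin j → Bool) :
      PQ {v} = ENNReal.ofReal (∏ i, if v i then q i else 1 - q i) := by
    rw [hPQ, ENNReal.ofReal_prod_of_nonneg]
    · exact Finset.prod_congr rfl fun i _ => by split_ifs <;> rfl
    · intro i _
      split_ifs
      exacts [(hq i).1, sub_nonneg.2 (hq i).2]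
  have hnonneg (v : Fin j → Bool) : 0 ≤ ∏ i, if v i then q i else 1 - q i :=
    Finset.prod_nonneg fun i _ => by
      split_ifs
      exacts [(hq i).1, sub_nonneg.2 (hq i).2]
  have hzero : PY {z} - PQ {z} ≤ ENNReal.ofReal (∑ i, max (q i - p i) 0) := by
    rw [hPY0, hprod, ← ENNReal.ofReal_sub _ (hnonneg z)]
    refine ENNReal.ofReal_le_ofReal ?_
    have hQ := one_sub_sum_le_prod_one_sub Finset.univ q hq
    have hle : ∑ i, (q i - p i) ≤ ∑ i, max (q i - p i) 0 :=
      Finset.sum_le_sum fun i _ => le_max_left _ _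
    rw [Finset.sum_sub_distrib] at hle
    simp only [hz, Bool.false_eq_true, if_false]
    linarith
  have hone (i : Fin j) : PY {e i} - PQ {e i} ≤
      ENNReal.ofReal (max (p i - q i) 0 + ∑ l, if i ≠ l then q i * q l else 0) := by
    rw [hPYe, hprod, ← ENNReal.ofReal_sub _ (hnonneg (e i))]
    refine ENNReal.ofReal_le_ofReal ?_
    have hP : (∏ l, if e i l then q l else 1 - q l)
        = q i * ∏ l ∈ Finset.univ.erase i, (1 - q l) := by
      rw [← Finset.mul_prod_erase _ _ (Finset.mem_univ i)]
      congr 1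
      · simp [he]
      · exact Finset.prod_congr rfl fun l hl => by simp [he, Finset.ne_of_mem_erase hl]
    have hS : (∑ l, if i ≠ l then q i * q l else 0)
        = q i * ∑ l ∈ Finset.univ.erase i, q l := by
      rw [← Finset.add_sum_erase _ _ (Finset.mem_univ i), Finset.mul_sum]
      simp only [ne_eq, not_true_eq_false, if_false, zero_add]
      exact Finset.sum_congr rfl fun l hl => if_pos (Finset.ne_of_mem_erase hl).symm
    rw [hP, hS]
    have := mul_le_mul_of_nonneg_left
      (one_sub_sum_le_prod_one_sub (Finset.univ.erase i) q hq) (hq i).1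
    linarith [le_max_left (p i - q i) 0]
  have hsupp (v : Fin j → Bool) (hv : v ∉ insert z (Finset.univ.image e)) :
      PY {v} - PQ {v} = 0 := by
    simp only [Finset.mem_insert, Finset.mem_image, Finset.mem_univ, true_and, not_or,
      not_exists] at hv
    obtain ⟨i, hi⟩ : ∃ i, v i = true := by
      by_contra! h
      exact hv.1 (funext fun i => by simpa using h i)
    obtain ⟨l, hil, hl⟩ : ∃ l, i ≠ l ∧ v l = true := by
      by_contra! h
      refine hv.2 i (funext fun l => ?_)
      by_cases hl : l = i
      · simp [he, hl, hi]
      · simpa [he, hl] using (h l (Ne.symm hl))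
    rw [hPY2 v ⟨i, l, hil, hi, hl⟩, zero_tsub]
  have hz_notMem : z ∉ Finset.univ.image e := by
    simp only [Finset.mem_image, Finset.mem_univ, true_and, not_exists]
    intro i hi
    simpa [he, hz] using congrFun hi i
  have he_inj : Function.Injective e := fun i l hil => by
    simpa [he] using congrFun hil i
  have hS_nonneg (i : Fin j) : 0 ≤ ∑ l, if i ≠ l then q i * q l else 0 :=
    Finset.sum_nonneg fun l _ => by
      split_ifs
      exacts [mul_nonneg (hq i).1 (hq l).1, le_rfl]
  rw [← Finset.sum_subset (Finset.subset_univ _) fun v _ hv => hsupp v hv,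
    Finset.sum_insert hz_notMem, Finset.sum_image he_inj.injOn]
  refine (add_le_add hzero (Finset.sum_le_sum fun i _ => hone i)).trans_eq ?_
  rw [← ENNReal.ofReal_sum_of_nonneg fun i _ => add_nonneg (le_max_right _ _) (hS_nonneg i),
    ← ENNReal.ofReal_add (Finset.sum_nonneg fun i _ => le_max_right _ _)
      (Finset.sum_nonneg fun i _ => add_nonneg (le_max_right _ _) (hS_nonneg i)),
    Finset.sum_add_distrib, ← add_assoc, ← Finset.sum_add_distrib]
  congr 3
  funext i
  rcases le_total (p i) (q i) with h | h
  · rw [max_eq_left (sub_nonneg.2 h), max_eq_right (sub_nonpos.2 h), add_zero, abs_sub_comm,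
      abs_of_nonneg (sub_nonneg.2 h)]
  · rw [max_eq_right (sub_nonpos.2 h), max_eq_left (sub_nonneg.2 h), zero_add,
      abs_of_nonneg (sub_nonneg.2 h)]
end

section
/- Let (Ω, ℱ, P) be a probability space, let q ∈ (0,1) and ε > 0, and let A, B, C ∈ ℱ be a measurable partition of Ω with P(A) ≥ q. Let ψ, φ, η : Ω → [0,∞) be random variables such that φ is independent of the σ-algebra generated by {A, B, C}, η is independent of the σ-algebra generated by {A, B, C}, and P(φ > ε·m) ≤ (1−q)^m and P(η > ε·m) ≤ (1−q)^m for every integer m ≥ 0. Suppose that ψ ≤ ε everywhere on A, ψ ≤ ε + φ everywhere on B, and ψ ≤ ε + η everywhere on C. Then P(ψ > ε·m) ≤ (1−q)^m for every integer m ≥ 0. -/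
open MeasureTheory ProbabilityTheory Set

/-- For pairwise disjoint events `A`, `B`, `C`, a lower bound on `P A` bounds `P B + P C` from above. -/
lemma measure_add_measure_le_ofReal_one_sub {Ω : Type*} [MeasurableSpace Ω] {P : Measure Ω}
    [IsProbabilityMeasure P] {q : ℝ} (hq : 0 ≤ q) {A B C : Set Ω} (hA : MeasurableSet A)
    (hC : MeasurableSet C) (hAB : Disjoint A B) (hAC : Disjoint A C) (hBC : Disjoint B C)
    (hPA : ENNReal.ofReal q ≤ P A) : P B + P C ≤ ENNReal.ofReal (1 - q) := by
  have hsub : B ∪ C ⊆ Aᶜ :=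
    union_subset hAB.subset_compl_left hAC.subset_compl_left
  calc P B + P C = P (B ∪ C) := (measure_union hBC hC).symm
    _ ≤ P Aᶜ := measure_mono hsub
    _ = 1 - P A := prob_compl_eq_one_sub hA
    _ ≤ 1 - ENNReal.ofReal q := tsub_le_tsub_left hPA 1
    _ = ENNReal.ofReal (1 - q) := by rw [ENNReal.ofReal_sub _ hq, ENNReal.ofReal_one]

/-- If `f` is independent of `m`, then `P (f > t, s) = P (f > t) * P s` for every event `s` of `m`. -/
lemma measure_lt_inter_eq_mul {Ω : Type*} [MeasurableSpace Ω] {P : Measure Ω} {f : Ω → ℝ}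
    {m : MeasurableSpace Ω} (hf : Indep (MeasurableSpace.comap f inferInstance) m P)
    (t : ℝ) {s : Set Ω} (hs : MeasurableSet[m] s) :
    P ({ω | t < f ω} ∩ s) = P {ω | t < f ω} * P s :=
  (Indep_iff _ _ P).mp hf _ _ ⟨Ioi t, measurableSet_Ioi, rfl⟩ hs

/-- Geometric-domination induction step: if `ψ ≤ ε` on `A`, `ψ ≤ ε + φ` on `B`,
`ψ ≤ ε + η` on `C`, where `{A,B,C}` is a measurable partition with `P(A) ≥ q`, and the
nonnegative variables `φ, η` are independent of `σ({A,B,C})` and dominated by `ε` times a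
Geometric(`q`) variable, then so is `ψ`. -/
theorem geometric_domination_induction_step
    {Ω : Type} [MeasurableSpace Ω] (P : Measure Ω) [IsProbabilityMeasure P]
    (q ε : ℝ) (hq : q ∈ Set.Ioo (0:ℝ) 1) (hε : 0 < ε)
    (A B C : Set Ω) (hA : MeasurableSet A) (hB : MeasurableSet B) (hC : MeasurableSet C)
    (hABd : Disjoint A B) (hACd : Disjoint A C) (hBCd : Disjoint B C)
    (hcover : A ∪ B ∪ C = Set.univ)
    (hPA : ENNReal.ofReal q ≤ P A)
    (ψ φ η : Ω → ℝ)
    (hψ0 : ∀ ω, 0 ≤ ψ ω) (hφ0 : ∀ ω, 0 ≤ φ ω) (hη0 : ∀ ω, 0 ≤ η ω)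
    (hψmeas : Measurable ψ) (hφmeas : Measurable φ) (hηmeas : Measurable η)
    (hφindep : Indep (MeasurableSpace.comap φ inferInstance)
      (MeasurableSpace.generateFrom {A, B, C}) P)
    (hηindep : Indep (MeasurableSpace.comap η inferInstance)
      (MeasurableSpace.generateFrom {A, B, C}) P)
    (hφtail : ∀ m : ℕ, P {ω | ε * m < φ ω} ≤ ENNReal.ofReal ((1 - q) ^ m))
    (hηtail : ∀ m : ℕ, P {ω | ε * m < η ω} ≤ ENNReal.ofReal ((1 - q) ^ m))
    (hψA : ∀ ω ∈ A, ψ ω ≤ ε)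
    (hψB : ∀ ω ∈ B, ψ ω ≤ ε + φ ω)
    (hψC : ∀ ω ∈ C, ψ ω ≤ ε + η ω) :
    ∀ m : ℕ, P {ω | ε * m < ψ ω} ≤ ENNReal.ofReal ((1 - q) ^ m) := by
  intro m
  cases m with
  | zero => simpa using prob_le_one
  | succ m =>
    have hr : 0 ≤ 1 - q := by linarith [hq.2]
    have hBgen : MeasurableSet[MeasurableSpace.generateFrom {A, B, C}] B :=
      MeasurableSpace.measurableSet_generateFrom (by simp)
    have hCgen : MeasurableSet[MeasurableSpace.generateFrom {A, B, C}] C :=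
      MeasurableSpace.measurableSet_generateFrom (by simp)
    have hsub : {ω | ε * (m + 1 : ℕ) < ψ ω} ⊆
        ({ω | ε * m < φ ω} ∩ B) ∪ ({ω | ε * m < η ω} ∩ C) := by
      intro ω hω
      have hlt : ε * m + ε < ψ ω := by
        simpa [mul_add] using hω
      have hmem : ω ∈ A ∪ B ∪ C := hcover ▸ mem_univ ω
      rcases hmem with (h | h) | h
      · have hnonneg : 0 ≤ ε * m := by positivity
        linarith [hψA ω h]
      · exact Or.inl ⟨show ε * m < φ ω by linarith [hψB ω h], h⟩
      · exact Or.inr ⟨show ε * m < η ω by linarith [hψC ω h], h⟩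
    calc P {ω | ε * (m + 1 : ℕ) < ψ ω}
        ≤ P ({ω | ε * m < φ ω} ∩ B) + P ({ω | ε * m < η ω} ∩ C) :=
          (measure_mono hsub).trans (measure_union_le _ _)
      _ = P {ω | ε * m < φ ω} * P B + P {ω | ε * m < η ω} * P C := by
          rw [measure_lt_inter_eq_mul hφindep _ hBgen, measure_lt_inter_eq_mul hηindep _ hCgen]
      _ ≤ ENNReal.ofReal ((1 - q) ^ m) * P B + ENNReal.ofReal ((1 - q) ^ m) * P C := by
          gcongr
          · exact hφtail m
          · exact hηtail m
      _ = ENNReal.ofReal ((1 - q) ^ m) * (P B + P C) := (mul_add _ _ _).symm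
      _ ≤ ENNReal.ofReal ((1 - q) ^ m) * ENNReal.ofReal (1 - q) := by
          gcongr
          exact measure_add_measure_le_ofReal_one_sub hq.1.le hA hC hABd hACd hBCd hPA
      _ = ENNReal.ofReal ((1 - q) ^ (m + 1)) := by
          rw [← ENNReal.ofReal_mul (pow_nonneg hr m), pow_succ]
end

section
/- Fix integers k ≥ 1 and n ≥ 1 and set h = n^{−k/(k+1)}. Let Π ⊆ [0,∞) × [0,∞) be any set of points such that no point of Π has either coordinate equal to an integer multiple of h. Define R : [0,∞) → [0,∞) by R(t) = min( t, inf{ x + (t − s) : (s,x) ∈ Π, s ≤ t } ), where the infimum of the empty set is +∞. For integers i, j ≥ 1 let I_{i,j} = 1 if Π ∩ ( ((j−1)h, jh) × ((i−1)h, ih) ) is nonempty and I_{i,j} = 0 otherwise. Define C_0 = 1 and, recursively for m ≥ 1, M_m = min{ i ≤ C_{m−1} : I_{i,m} = 1 } (with M_m = ∞ if no such i exists), and C_m = C_{m−1} + 1 if M_m = ∞ while C_m = M_m otherwise. Then for every integer m ≥ 0, |C_m·h − R(m·h)| ≤ h. -/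
open Set

/-- A nonnegative real that avoids the grid `h ℕ` lies in the interior of a grid cell. -/
lemma exists_mem_Ioo_grid {h x : ℝ} (hh : 0 < h) (hx : 0 ≤ x) (hg : ∀ i : ℕ, x ≠ i * h) :
    ∃ i : ℕ, 1 ≤ i ∧ x ∈ Ioo (((i : ℝ) - 1) * h) (i * h) := by
  refine ⟨⌊x / h⌋₊ + 1, by omega, ?_, ?_⟩
  · have h1 := Nat.floor_le (div_nonneg hx hh.le)
    rw [le_div_iff₀ hh] at h1
    push_cast
    rw [add_sub_cancel_right]
    exact lt_of_le_of_ne h1 (hg _).symm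
  · have h1 := Nat.lt_floor_add_one (x / h)
    rw [div_lt_iff₀ hh] at h1
    exact_mod_cast h1

/-- Growth by one step when no point lies below level `C * h` in the current strip, and a drop to
the lowest occupied cell otherwise, keeps the discretization within one cell of the set of
constraints: it is a lower bound up to one cell, and one of the constraints is at most one cell
higher. -/
lemma discretization_bounds {h : ℝ} (hh : 0 < h) {pts : Set (ℝ × ℝ)}
    (hsub : pts ⊆ Ici (0 : ℝ) ×ˢ Ici (0 : ℝ))
    (hgrid : ∀ p ∈ pts, ∀ i : ℕ, p.1 ≠ (i : ℝ) * h ∧ p.2 ≠ (i : ℝ) * h)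
    {I : ℕ → ℕ → Prop}
    (hI : ∀ i j : ℕ, 1 ≤ i → 1 ≤ j →
      (I i j ↔ (pts ∩ (Ioo (((j : ℝ) - 1) * h) ((j : ℝ) * h) ×ˢ
         Ioo (((i : ℝ) - 1) * h) ((i : ℝ) * h))).Nonempty))
    {C : ℕ → ℕ} (hC0 : C 0 = 1)
    (hC : ∀ m : ℕ, 1 ≤ m →
      ({i : ℕ | 1 ≤ i ∧ i ≤ C (m - 1) ∧ I i m} = ∅ → C m = C (m - 1) + 1) ∧
      ({i : ℕ | 1 ≤ i ∧ i ≤ C (m - 1) ∧ I i m}.Nonempty →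
        C m = sInf {i : ℕ | 1 ≤ i ∧ i ≤ C (m - 1) ∧ I i m})) (m : ℕ) :
    (∀ y ∈ insert ((m : ℝ) * h)
        {y : ℝ | ∃ s x : ℝ, (s, x) ∈ pts ∧ s ≤ m * h ∧ y = x + (m * h - s)},
      ((C m : ℝ) - 1) * h ≤ y) ∧
    ∃ y ∈ insert ((m : ℝ) * h)
        {y : ℝ | ∃ s x : ℝ, (s, x) ∈ pts ∧ s ≤ m * h ∧ y = x + (m * h - s)},
      y ≤ ((C m : ℝ) + 1) * h := by
  induction m with
  | zero =>
    refine ⟨?_, 0, by simp, by positivity⟩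
    rintro y (rfl | ⟨s, x, hp, hs, rfl⟩)
    · simp [hC0]
    · have hx : 0 ≤ x := (hsub hp).2
      simp only [hC0, Nat.cast_zero, Nat.cast_one, sub_self, zero_mul] at hs ⊢
      linarith
  | succ m ih =>
    obtain ⟨hlow, y, hy, hyC⟩ := ih
    have hstep := hC (m + 1) (by omega)
    rw [Nat.add_sub_cancel] at hstep
    have hold : ∀ s x : ℝ, (s, x) ∈ pts → s ≤ m * h →
        (C m : ℝ) * h ≤ x + (((m + 1 : ℕ) : ℝ) * h - s) := by
      intro s x hp hs
      have := hlow _ (Or.inr ⟨s, x, hp, hs, rfl⟩)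
      push_cast
      linarith
    have hself : (C m : ℝ) * h ≤ ((m + 1 : ℕ) : ℝ) * h := by
      have := hlow _ (Or.inl rfl)
      push_cast
      linarith
    have hnew : ∀ s x : ℝ, (s, x) ∈ pts → m * h < s → s ≤ ((m + 1 : ℕ) : ℝ) * h →
        ∃ i : ℕ, 1 ≤ i ∧ I i (m + 1) ∧ ((i : ℝ) - 1) * h ≤ x := by
      intro s x hp hs hs'
      obtain ⟨i, hi, hxi⟩ := exists_mem_Ioo_grid hh (hsub hp).2 fun i => (hgrid _ hp i).2
      refine ⟨i, hi, (hI i (m + 1) hi (by omega)).2 ⟨(s, x), hp, ⟨?_, ?_⟩, hxi⟩, hxi.1.le⟩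
      · push_cast
        simpa using hs
      · exact lt_of_le_of_ne hs' (hgrid _ hp _).1
    rcases eq_empty_or_nonempty {i : ℕ | 1 ≤ i ∧ i ≤ C m ∧ I i (m + 1)} with he | hne
    · rw [hstep.1 he]
      refine ⟨?_, y + h, ?_, by push_cast; linarith⟩
      · push_cast [add_sub_cancel_right]
        rintro z (rfl | ⟨s, x, hp, hs, rfl⟩)
        · exact_mod_cast hself
        rcases le_or_gt s (m * h) with hsm | hsm
        · exact_mod_cast hold s x hp hsm
        · obtain ⟨i, hi, hiI, hix⟩ := hnew s x hp hsm (by exact_mod_cast hs)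
          have hCi : C m + 1 ≤ i := by
            by_contra hlt
            exact he.subset (show i ∈ _ from ⟨hi, by omega, hiI⟩)
          have hCi' : (C m : ℝ) + 1 ≤ i := by exact_mod_cast hCi
          nlinarith
      · rcases hy with rfl | ⟨s, x, hp, hs, rfl⟩
        · left
          push_cast
          ring
        · right
          refine ⟨s, x, hp, ?_, ?_⟩ <;> push_cast <;> linarith
    · have hmem := Nat.sInf_mem hne
      rw [← hstep.2 hne] at hmem
      obtain ⟨h1, hle, hIm⟩ := hmem
      have hle' : (C (m + 1) : ℝ) ≤ C m := by exact_mod_cast hle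
      refine ⟨?_, ?_⟩
      · rintro z (rfl | ⟨s, x, hp, hs, rfl⟩)
        · nlinarith
        rcases le_or_gt s (m * h) with hsm | hsm
        · nlinarith [hold s x hp hsm]
        · obtain ⟨i, hi, hiI, hix⟩ := hnew s x hp hsm hs
          have hCi : C (m + 1) ≤ i := by
            by_contra hlt
            have := Nat.sInf_le (show i ∈ {i : ℕ | 1 ≤ i ∧ i ≤ C m ∧ I i (m + 1)} from
              ⟨hi, by omega, hiI⟩)
            rw [← hstep.2 hne] at this
            omega
          have hCi' : (C (m + 1) : ℝ) ≤ i := by exact_mod_cast hCi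
          nlinarith
      · obtain ⟨⟨s, x⟩, hp, hs, hx⟩ := (hI _ _ h1 (by omega)).1 hIm
        refine ⟨_, Or.inr ⟨s, x, hp, hs.2.le, rfl⟩, ?_⟩
        have hs1 := hs.1
        have hx2 := hx.2
        push_cast at hs1 hx2 ⊢
        linarith

/-- Deterministic comparison of the `k`-Rayleigh process `R` driven by a point
configuration with its grid discretization `C` of mesh `h = n^{−k/(k+1)}`:
`|C_m·h − R(m·h)| ≤ h` for all `m`. -/
theorem rayleigh_discretization_close
    (k n : ℕ) (hk : 1 ≤ k) (hn : 1 ≤ n)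
    (pts : Set (ℝ × ℝ))
    (hsub : pts ⊆ Set.Ici (0:ℝ) ×ˢ Set.Ici (0:ℝ))
    (hgrid : ∀ p ∈ pts, ∀ i : ℕ,
      p.1 ≠ (i : ℝ) * (n : ℝ) ^ (-(k : ℝ) / (k + 1)) ∧
      p.2 ≠ (i : ℝ) * (n : ℝ) ^ (-(k : ℝ) / (k + 1)))
    (R : ℝ → ℝ)
    (hR : ∀ t : ℝ, R t = sInf (insert t
      {y : ℝ | ∃ s x : ℝ, (s, x) ∈ pts ∧ s ≤ t ∧ y = x + (t - s)}))
    (I : ℕ → ℕ → Prop)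
    (hI : ∀ i j : ℕ, 1 ≤ i → 1 ≤ j →
      (I i j ↔ (pts ∩
        (Set.Ioo (((j : ℝ) - 1) * (n : ℝ) ^ (-(k : ℝ) / (k + 1)))
            ((j : ℝ) * (n : ℝ) ^ (-(k : ℝ) / (k + 1))) ×ˢ
         Set.Ioo (((i : ℝ) - 1) * (n : ℝ) ^ (-(k : ℝ) / (k + 1)))
            ((i : ℝ) * (n : ℝ) ^ (-(k : ℝ) / (k + 1))))).Nonempty))
    (C : ℕ → ℕ)
    (hC0 : C 0 = 1)
    (hC : ∀ m : ℕ, 1 ≤ m →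
      ({i : ℕ | 1 ≤ i ∧ i ≤ C (m - 1) ∧ I i m} = ∅ → C m = C (m - 1) + 1) ∧
      ({i : ℕ | 1 ≤ i ∧ i ≤ C (m - 1) ∧ I i m}.Nonempty →
        C m = sInf {i : ℕ | 1 ≤ i ∧ i ≤ C (m - 1) ∧ I i m})) :
    ∀ m : ℕ,
      |(C m : ℝ) * (n : ℝ) ^ (-(k : ℝ) / (k + 1))
        - R ((m : ℝ) * (n : ℝ) ^ (-(k : ℝ) / (k + 1)))|
      ≤ (n : ℝ) ^ (-(k : ℝ) / (k + 1)) := by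
  intro m
  have hh : 0 < (n : ℝ) ^ (-(k : ℝ) / (k + 1)) :=
    Real.rpow_pos_of_pos (by exact_mod_cast hn) _
  generalize (n : ℝ) ^ (-(k : ℝ) / (k + 1)) = h at *
  obtain ⟨hlow, y, hy, hyC⟩ := discretization_bounds hh hsub hgrid hI hC0 hC m
  have hge : ((C m : ℝ) - 1) * h ≤ R (m * h) := by
    rw [hR]
    exact le_csInf (insert_nonempty _ _) hlow
  have hle : R (m * h) ≤ ((C m : ℝ) + 1) * h := by
    rw [hR]
    exact (csInf_le ⟨_, hlow⟩ hy).trans hyC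
  rw [abs_le]
  constructor <;> linarith
end

section
/- Fix β > 0. There exist constants 0 < c ≤ C < ∞, depending only on β, such that for every δ ∈ (0, 1/2], c·δ^{−(β+1)/β} ≤ Σ_{j=1}^{∞} exp( −((2jδ)^{β+1} − ((2j−2)δ)^{β+1})/(β+1) ) ≤ C·δ^{−(β+1)/β}. -/
open Real

/-- Tangent line inequality for the convex function `x ↦ x ^ (β + 1)` on `[0, ∞)`. -/
lemma rpow_add_one_tangent_le {β : ℝ} (hβ : 0 < β) {x y : ℝ} (hx : 0 ≤ x) (hy : 0 ≤ y) :
    x ^ (β + 1) + (β + 1) * (x ^ β * (y - x)) ≤ y ^ (β + 1) := by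
  rcases hx.eq_or_lt with rfl | hx
  · simp only [zero_rpow hβ.ne', zero_rpow (by positivity : β + 1 ≠ 0)]
    simpa using rpow_nonneg hy _
  · have h1 : -1 ≤ y / x - 1 := by
      have : 0 ≤ y / x := by positivity
      linarith
    have h := one_add_mul_self_le_rpow_one_add h1 (by linarith : 1 ≤ β + 1)
    rw [add_sub_cancel, div_rpow hy hx.le, le_div_iff₀ (by positivity)] at h
    refine le_trans (le_of_eq ?_) h
    rw [rpow_add_one hx.ne']
    field_simp

/-- The stretched exponential `exp (-x ^ β)` decays at least like `(1 + x) ^ (-2)`. -/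
lemma exists_exp_neg_rpow_le {β : ℝ} (hβ : 0 < β) :
    ∃ K : ℝ, 1 ≤ K ∧ ∀ x : ℝ, 0 ≤ x → exp (-x ^ β) ≤ K / (1 + x) ^ 2 := by
  obtain ⟨n, hn⟩ := exists_nat_ge (2 / β)
  rw [div_le_iff₀ hβ] at hn
  refine ⟨4 * (1 + n.factorial), by
    have : (0 : ℝ) ≤ n.factorial := by positivity
    linarith, fun x hx => ?_⟩
  have hpow : (x ^ β) ^ n ≤ n.factorial * exp (x ^ β) := by
    have h := pow_div_factorial_le_exp (x ^ β) (by positivity) n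
    rwa [div_le_iff₀' (by positivity)] at h
  have hone : 1 ≤ exp (x ^ β) := one_le_exp (by positivity)
  have hsq : (1 + x) ^ 2 ≤ 4 * (1 + (x ^ β) ^ n) := by
    have hn0 : 0 ≤ (x ^ β) ^ n := by positivity
    rcases le_total x 1 with h | h
    · nlinarith
    · have : x ^ 2 ≤ (x ^ β) ^ n := by
        rw [← rpow_natCast (x ^ β), ← rpow_mul hx, ← rpow_natCast x 2]
        exact rpow_le_rpow_of_exponent_le h (by push_cast; linarith)
      nlinarith
  rw [exp_neg, le_div_iff₀ (by positivity), inv_mul_le_iff₀ (by positivity)]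
  linarith

/-- A telescoping bound for the partial sums of `(1 + s * j) ^ (-2)`. -/
lemma sum_range_one_div_one_add_mul_sq_le {s : ℝ} (hs : 0 < s) (hs1 : s ≤ 1) (n : ℕ) :
    ∑ j ∈ Finset.range n, 1 / (1 + s * (j : ℝ)) ^ 2 ≤ 2 / s := by
  have h : ∑ j ∈ Finset.range n, 1 / (1 + s * (j : ℝ)) ^ 2
      ≤ 2 / s * (1 - 1 / (1 + s * (n : ℝ))) := by
    induction n with
    | zero => simp
    | succ n ih =>
      rw [Finset.sum_range_succ]
      have hn : (0 : ℝ) ≤ n := n.cast_nonneg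
      have hsn : 0 ≤ s * n := by positivity
      have hstep : 1 / (1 + s * (n : ℝ)) ^ 2
          ≤ 2 / s * (1 / (1 + s * (n : ℝ)) - 1 / (1 + s * ((n + 1 : ℕ) : ℝ))) := by
        have h2 : 2 / s * (1 / (1 + s * (n : ℝ)) - 1 / (1 + s * ((n + 1 : ℕ) : ℝ)))
            = 2 / ((1 + s * n) * (1 + s * (n + 1))) := by
          push_cast
          field_simp
          ring
        rw [h2, div_le_div_iff₀ (by positivity) (by positivity)]
        nlinarith [mul_nonneg (by positivity : 0 ≤ 1 + s * n) (by linarith : 0 ≤ 1 + s * n - s)]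
      linarith
  refine h.trans (mul_le_of_le_one_right (by positivity) ?_)
  have : 0 ≤ 1 / (1 + s * (n : ℝ)) := by positivity
  linarith

/-- A series squeezed between `exp (-(s * (j + 1)) ^ β)` and `exp (-(s * j) ^ β)` is comparable
to `s⁻¹`. -/
lemma exists_tsum_bounds_of_exp_bounds {β : ℝ} (hβ : 0 < β) :
    ∃ K : ℝ, 1 ≤ K ∧ ∀ (s : ℝ) (f : ℕ → ℝ), 0 < s → s ≤ 1 →
      (∀ j : ℕ, exp (-(s * ((j : ℝ) + 1)) ^ β) ≤ f j) →
      (∀ j : ℕ, f j ≤ exp (-(s * (j : ℝ)) ^ β)) →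
      exp (-1) / 2 * s⁻¹ ≤ ∑' j, f j ∧ ∑' j, f j ≤ 2 * K * s⁻¹ := by
  obtain ⟨K, hK, hexp⟩ := exists_exp_neg_rpow_le hβ
  refine ⟨K, hK, fun s f hs hs1 hlow hup => ?_⟩
  have hf : ∀ j, 0 ≤ f j := fun j => (exp_pos _).le.trans (hlow j)
  have hpartial : ∀ n, ∑ j ∈ Finset.range n, f j ≤ 2 * K * s⁻¹ := fun n => calc
    ∑ j ∈ Finset.range n, f j
        ≤ ∑ j ∈ Finset.range n, K * (1 / (1 + s * (j : ℝ)) ^ 2) := by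
          refine Finset.sum_le_sum fun j _ => ((hup j).trans (hexp _ (by positivity))).trans_eq ?_
          ring
    _ = K * ∑ j ∈ Finset.range n, 1 / (1 + s * (j : ℝ)) ^ 2 := by rw [Finset.mul_sum]
    _ ≤ K * (2 / s) := by
          gcongr
          exact sum_range_one_div_one_add_mul_sq_le hs hs1 n
    _ = 2 * K * s⁻¹ := by ring
  have hsum : Summable f := summable_of_sum_range_le hf hpartial
  refine ⟨?_, Real.tsum_le_of_sum_range_le hf hpartial⟩
  have hinv : 1 ≤ s⁻¹ := (one_le_inv₀ hs).2 hs1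
  set N := ⌊s⁻¹⌋₊ with hN
  have hNle : (N : ℝ) ≤ s⁻¹ := Nat.floor_le (by positivity)
  have hN1 : (1 : ℝ) ≤ N := by exact_mod_cast Nat.le_floor (by simpa using hinv)
  have hNlt : s⁻¹ < N + 1 := Nat.lt_floor_add_one _
  calc exp (-1) / 2 * s⁻¹ ≤ N * exp (-1) := by nlinarith [exp_pos (-1)]
    _ = ∑ j ∈ Finset.range N, exp (-1) := by simp
    _ ≤ ∑ j ∈ Finset.range N, f j := by
        refine Finset.sum_le_sum fun j hj => le_trans ?_ (hlow j)
        have hjN : (j : ℝ) + 1 ≤ N := by exact_mod_cast Finset.mem_range.1 hj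
        have hle : s * ((j : ℝ) + 1) ≤ 1 := calc
          s * ((j : ℝ) + 1) ≤ s * s⁻¹ := by gcongr; linarith
          _ = 1 := mul_inv_cancel₀ hs.ne'
        have := rpow_le_one (by positivity) hle hβ.le
        gcongr
    _ ≤ ∑' j, f j := hsum.sum_le_tsum _ fun j _ => hf j

open Real

/-- Two-sided bound for the expected packing size in the stick-breaking tree: for
`δ ∈ (0, 1/2]`, the sum `Σ_{j≥1} exp(−((2jδ)^{β+1} − ((2j−2)δ)^{β+1})/(β+1))` is comparable
to `δ^{−(β+1)/β}`, with constants depending only on `β`. -/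
theorem packing_sum_two_sided_bound
    (β : ℝ) (hβ : 0 < β) :
    ∃ c C : ℝ, 0 < c ∧ c ≤ C ∧
      ∀ δ : ℝ, δ ∈ Set.Ioc (0:ℝ) (1/2) →
        c * δ ^ (-(β + 1) / β)
          ≤ (∑' j : ℕ, Real.exp
              (-(((2 * ((j : ℝ) + 1) * δ) ^ (β + 1)
                  - (2 * (j : ℝ) * δ) ^ (β + 1)) / (β + 1)))) ∧
        (∑' j : ℕ, Real.exp
            (-(((2 * ((j : ℝ) + 1) * δ) ^ (β + 1)
                - (2 * (j : ℝ) * δ) ^ (β + 1)) / (β + 1))))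
          ≤ C * δ ^ (-(β + 1) / β) := by
  obtain ⟨K, hK, hbounds⟩ := exists_tsum_bounds_of_exp_bounds hβ
  have hexp : exp (-1) ≤ 1 := exp_le_one_iff.2 (by norm_num)
  refine ⟨exp (-1) / 2 * (2 ^ ((β + 1) / β))⁻¹, 2 * K * (2 ^ ((β + 1) / β))⁻¹,
    by positivity, ?_, ?_⟩
  · gcongr
    linarith
  rintro δ ⟨hδ, hδ1⟩
  set s : ℝ := (2 * δ) ^ ((β + 1) / β) with hs
  have hs0 : 0 < s := by positivity
  have hs1 : s ≤ 1 := rpow_le_one (by positivity) (by linarith) (by positivity)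
  have hscale : ∀ t : ℝ, 0 ≤ t → (s * t) ^ β = (2 * t * δ) ^ β * (2 * δ) := fun t ht => by
    rw [mul_rpow hs0.le ht, hs, ← rpow_mul (by positivity), div_mul_cancel₀ _ hβ.ne',
      rpow_add_one (by positivity), show 2 * t * δ = 2 * δ * t by ring,
      mul_rpow (by positivity) ht]
    ring
  have hinv : (2 ^ ((β + 1) / β))⁻¹ * δ ^ (-(β + 1) / β) = s⁻¹ := by
    rw [hs, mul_rpow (by norm_num) hδ.le, neg_div, rpow_neg hδ.le, mul_inv]
  rw [mul_assoc, hinv, mul_assoc (2 * K), hinv]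
  refine hbounds s _ hs0 hs1 (fun j => ?_) (fun j => ?_)
  · rw [hscale _ (by positivity), exp_le_exp, neg_le_neg_iff, div_le_iff₀ (by positivity)]
    have h := rpow_add_one_tangent_le hβ (x := 2 * ((j : ℝ) + 1) * δ) (y := 2 * (j : ℝ) * δ)
      (by positivity) (by positivity)
    linarith
  · rw [hscale _ (by positivity), exp_le_exp, neg_le_neg_iff, le_div_iff₀ (by positivity)]
    have h := rpow_add_one_tangent_le hβ (x := 2 * (j : ℝ) * δ) (y := 2 * ((j : ℝ) + 1) * δ)
      (by positivity) (by positivity)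
    linarith
end
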